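/- arXiv:1905.11397 — 2 statements merged into one kernel-verified Lean document; each statement's English description precedes it below -/
import Mathlib

section
/- In the filtered MAB setting, for every arm k with E[N_k(𝒯)] < ∞, the stopped sum S_k(𝒯) is integrable and E[S_k(𝒯)] = μ_k · E[N_k(𝒯)] (Wald's first identity generalized to multi-armed bandits with adaptive sampling and adaptive stopping). -/
open MeasureTheory ProbabilityTheory Filter

/-- The filtered multi-armed bandit setting: a filtration `(𝔉_t)_{t≥0}`, arm
distributions `P_1, …, P_K` on `ℝ` with finite first moments, a predictable arm-choice
process `(A_t)_{t≥1}`, and an adapted observation process `(Y_t)_{t≥1}` such that,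
conditionally on `𝔉_{t−1}`, on the event `{A_t = k}` the observation `Y_t` has law
`P_k`: for every bounded Borel `φ`,
`E[1{A_t=k} φ(Y_t) | 𝔉_{t−1}] = 1{A_t=k} ∫ φ dP_k` a.s. -/
structure FilteredMAB (Ω : Type) [m0 : MeasurableSpace Ω] (P : Measure Ω) (K : ℕ) where
  F : Filtration ℕ m0
  arm : Fin K → Measure ℝ
  arm_prob : ∀ k, IsProbabilityMeasure (arm k)
  arm_int : ∀ k, Integrable (fun x => x) (arm k)
  A : ℕ → Ω → Fin K
  Y : ℕ → Ω → ℝ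
  A_pred : ∀ t, 1 ≤ t → Measurable[F (t - 1)] (A t)
  Y_adapted : ∀ t, Measurable[F t] (Y t)
  cond : ∀ t, 1 ≤ t → ∀ k : Fin K, ∀ φ : ℝ → ℝ, Measurable φ → (∃ C, ∀ x, |φ x| ≤ C) →
    (P[(fun ω => if A t ω = k then φ (Y t ω) else 0) | F (t - 1)])
      =ᵐ[P] fun ω => if A t ω = k then ∫ x, φ x ∂(arm k) else 0

namespace FilteredMAB

variable {Ω : Type} [MeasurableSpace Ω] {P : Measure Ω} {K : ℕ}

/-- `N_k(t)`: the number of draws from arm `k` among times `1, …, t`. -/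
def N (M : FilteredMAB Ω P K) (k : Fin K) (t : ℕ) (ω : Ω) : ℕ :=
  ∑ s ∈ Finset.Icc 1 t, if M.A s ω = k then 1 else 0

/-- `S_k(t)`: the running sum of the observations from arm `k` among times `1, …, t`. -/
def S (M : FilteredMAB Ω P K) (k : Fin K) (t : ℕ) (ω : Ω) : ℝ :=
  ∑ s ∈ Finset.Icc 1 t, if M.A s ω = k then M.Y s ω else 0

/-- The mean `μ_k` of the `k`-th arm. -/
noncomputable def mu (M : FilteredMAB Ω P K) (k : Fin K) : ℝ := ∫ x, x ∂(M.arm k)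

end FilteredMAB

/-- Restricted to an `𝔉_{t-1}`-event contained in `{A_t = k}`, `Y_t` has law `P(G) • P_k`. -/
theorem mab_map_restrict {Ω : Type} [MeasurableSpace Ω] {P : Measure Ω} [IsProbabilityMeasure P]
    {K : ℕ} (M : FilteredMAB Ω P K) (k : Fin K) (t : ℕ) (ht : 1 ≤ t) (G : Set Ω)
    (hG : MeasurableSet[M.F (t - 1)] G) (hGA : ∀ ω ∈ G, M.A t ω = k) :
    (P.restrict G).map (M.Y t) = P G • M.arm k := by
  have := M.arm_prob k
  have hY : Measurable (M.Y t) := (M.Y_adapted t).mono (M.F.le t) le_rfl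
  have hA : Measurable (M.A t) := (M.A_pred t ht).mono (M.F.le _) le_rfl
  have hG0 : MeasurableSet G := M.F.le _ _ hG
  ext B hB
  rw [Measure.map_apply hY hB, Measure.smul_apply, smul_eq_mul,
    Measure.restrict_apply (hY hB)]
  have hc := M.cond t ht k (B.indicator (fun _ => (1 : ℝ))) (measurable_const.indicator hB)
    ⟨1, fun x => by by_cases h : x ∈ B <;> simp [h]⟩
  set g : Ω → ℝ := fun ω => if M.A t ω = k then B.indicator (fun _ => (1 : ℝ)) (M.Y t ω) else 0
  have hgm : Measurable g := by
    refine Measurable.ite (hA (measurableSet_singleton k)) ?_ measurable_const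
    exact (measurable_const.indicator hB).comp hY
  have hgi : Integrable g P := by
    refine Integrable.of_bound hgm.aestronglyMeasurable 1 (ae_of_all _ fun ω => ?_)
    by_cases h : M.A t ω = k <;> by_cases h' : M.Y t ω ∈ B <;> simp [g, h, h']
  have h1 : ∫ ω in G, g ω ∂P = P.real (M.Y t ⁻¹' B ∩ G) := by
    rw [← integral_indicator hG0]
    have : G.indicator g = (M.Y t ⁻¹' B ∩ G).indicator (fun _ => (1 : ℝ)) := by
      ext ω
      by_cases h : ω ∈ G
      · by_cases h' : M.Y t ω ∈ B <;> simp [g, h, h', hGA ω h]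
      · simp [h]
    rw [this, integral_indicator ((hY hB).inter hG0)]
    simp [Measure.real]
  have h2 : ∫ ω in G, g ω ∂P = P.real G * (M.arm k).real B := by
    rw [← setIntegral_condExp (M.F.le (t - 1)) hgi hG, integral_congr_ae (ae_restrict_of_ae hc),
      setIntegral_congr_fun (g := fun _ => (M.arm k).real B) hG0]
    · simp [Measure.real]
    · intro ω hω
      simp only [hGA ω hω, if_true]
      rw [integral_indicator hB]
      simp [Measure.real]
  have h3 := h1.symm.trans h2
  rw [Measure.real, Measure.real, Measure.real, ← ENNReal.toReal_mul] at h3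
  exact (ENNReal.toReal_eq_toReal_iff' (measure_ne_top _ _)
    (ENNReal.mul_ne_top (measure_ne_top _ _) (measure_ne_top _ _))).1 h3

/-- The event `{A_{s+1} = k, τ ≥ s+1}`. -/
def mabG {Ω : Type} [MeasurableSpace Ω] {P : Measure Ω}
    {K : ℕ} (M : FilteredMAB Ω P K) (τ : Ω → ℕ∞) (k : Fin K) (s : ℕ) : Set Ω :=
  {ω | M.A (s + 1) ω = k ∧ (s : ℕ∞) < τ ω}

theorem mab_stopped_sum {Ω : Type} [MeasurableSpace Ω] {P : Measure Ω}
    {K : ℕ} (M : FilteredMAB Ω P K) (τ : Ω → ℕ∞) (k : Fin K) (f : ℕ → Ω → ℝ) (ω : Ω) (t : ℕ) :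
    ∑ s ∈ Finset.Icc 1 (min (t : ℕ∞) (τ ω)).toNat, (if M.A s ω = k then f s ω else 0)
      = ∑ s ∈ Finset.range t, (mabG M τ k s).indicator (f (s + 1)) ω := by
  induction t with
  | zero => simp
  | succ t ih =>
    rw [Finset.sum_range_succ, ← ih]
    by_cases h : (t : ℕ∞) < τ ω
    · have h' : ((t + 1 : ℕ) : ℕ∞) ≤ τ ω := by
        push_cast
        exact Order.add_one_le_of_lt h
      rw [min_eq_left h', min_eq_left h.le, ENat.toNat_coe, ENat.toNat_coe,
        Finset.sum_Icc_succ_top (by omega)]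
      congr 1
      by_cases hA : M.A (t + 1) ω = k <;> simp [mabG, hA, h]
    · have h1 : τ ω ≤ (t : ℕ∞) := not_lt.1 h
      have h2 : τ ω ≤ ((t + 1 : ℕ) : ℕ∞) := h1.trans (by exact_mod_cast Nat.le_succ t)
      rw [min_eq_right h1, min_eq_right h2]
      simp [mabG, h]

theorem integrable_limit_of_summable {Ω : Type} [MeasurableSpace Ω] {P : Measure Ω}
    (f : ℕ → Ω → ℝ) (g : Ω → ℝ) (hf : ∀ i, Integrable (f i) P)
    (hs : Summable fun i => ∫ ω, ‖f i ω‖ ∂P) (hg : AEStronglyMeasurable g P)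
    (hlim : ∀ᵐ ω ∂P, Tendsto (fun t => ∑ s ∈ Finset.range t, f s ω) atTop (nhds (g ω))) :
    Integrable g P ∧ HasSum (fun i => ∫ ω, f i ω ∂P) (∫ ω, g ω ∂P) := by
  have hfin : ∑' i, ∫⁻ ω, ‖f i ω‖ₑ ∂P ≠ ⊤ := by
    have : ∀ i, ∫⁻ ω, ‖f i ω‖ₑ ∂P = ENNReal.ofReal (∫ ω, ‖f i ω‖ ∂P) := fun i =>
      (ofReal_integral_norm_eq_lintegral_enorm (hf i)).symm
    simp_rw [this]
    exact hs.tsum_ofReal_ne_top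
  rw [← lintegral_tsum (fun i => (hf i).1.enorm)] at hfin
  have hsum : ∀ᵐ ω ∂P, HasSum (fun i => f i ω) (g ω) := by
    have h1 := ae_lt_top' (AEMeasurable.ennreal_tsum fun i => (hf i).1.enorm) hfin
    filter_upwards [h1, hlim] with ω h h'
    have hsm : Summable fun i => f i ω := by
      refine Summable.of_enorm (h.ne)
    have := hsm.hasSum.tendsto_sum_nat
    rw [tendsto_nhds_unique h' this]
    exact hsm.hasSum
  constructor
  · refine ⟨hg, lt_of_le_of_lt (lintegral_mono_ae ?_) (lt_top_iff_ne_top.2 hfin)⟩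
    filter_upwards [hsum] with ω h
    rw [← h.tsum_eq]
    exact enorm_tsum_le_tsum_enorm
  · have := hasSum_integral_of_summable_integral_norm hf hs
    have he : ∫ ω, g ω ∂P = ∫ ω, ∑' i, f i ω ∂P := by
      refine integral_congr_ae ?_
      filter_upwards [hsum] with ω h
      exact h.tsum_eq.symm
    rw [he]
    exact this

/-- Wald's first identity generalized to multi-armed bandits with adaptive
sampling and adaptive stopping.  `𝒯` is a stopping time for the filtration (valued in
`ℕ∞`, with `𝒯 ≥ 1`), and `N_k(𝒯)` and `S_k(𝒯)` are the almost-sure limits of the stopped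
processes `N_k(t ∧ 𝒯)`, `S_k(t ∧ 𝒯)` (on `{𝒯 < ∞}` these are just the values at `𝒯`).
For every arm `k` with `E[N_k(𝒯)] < ∞`, the stopped sum `S_k(𝒯)` is integrable and
`E[S_k(𝒯)] = μ_k · E[N_k(𝒯)]`. -/
theorem wald_identity_mab
    {Ω : Type} [MeasurableSpace Ω] {P : Measure Ω} [IsProbabilityMeasure P]
    {K : ℕ} (hK : 1 ≤ K) (M : FilteredMAB Ω P K)
    (τ : Ω → ℕ∞)
    (hτ1 : ∀ ω, 1 ≤ τ ω)
    (hτ : ∀ t : ℕ, MeasurableSet[M.F t] {ω | τ ω ≤ t})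
    (k : Fin K)
    (NkT SkT : Ω → ℝ)
    (hNkT : ∀ᵐ ω ∂P, Tendsto
      (fun t : ℕ => (M.N k (min (t : ℕ∞) (τ ω)).toNat ω : ℝ)) atTop (nhds (NkT ω)))
    (hSkT : ∀ᵐ ω ∂P, Tendsto
      (fun t : ℕ => M.S k (min (t : ℕ∞) (τ ω)).toNat ω) atTop (nhds (SkT ω)))
    (hNmeas : AEStronglyMeasurable NkT P) (hSmeas : AEStronglyMeasurable SkT P)
    (hNint : Integrable NkT P) :
    Integrable SkT P ∧ ∫ ω, SkT ω ∂P = M.mu k * ∫ ω, NkT ω ∂P := by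
  have := M.arm_prob k
  set G := mabG M τ k with hGdef
  have hGF : ∀ s, MeasurableSet[M.F s] (G s) := by
    intro s
    have h1 : MeasurableSet[M.F s] (M.A (s + 1) ⁻¹' {k}) :=
      M.A_pred (s + 1) (by omega) (measurableSet_singleton k)
    have h2 := (hτ s).compl
    have : G s = (M.A (s + 1) ⁻¹' {k}) ∩ {ω | τ ω ≤ s}ᶜ := by
      ext ω
      simp [hGdef, mabG]
    rw [this]
    exact h1.inter h2
  have hG0 : ∀ s, MeasurableSet (G s) := fun s => M.F.le _ _ (hGF s)
  have hYm : ∀ s, Measurable (M.Y s) := fun s => (M.Y_adapted s).mono (M.F.le s) le_rfl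
  have hmap : ∀ s, (P.restrict (G s)).map (M.Y (s + 1)) = P (G s) • M.arm k := fun s =>
    mab_map_restrict M k (s + 1) (by omega) (G s) (hGF s) (fun ω h => h.1)
  have hYint : ∀ s, Integrable ((G s).indicator (M.Y (s + 1))) P := by
    intro s
    rw [integrable_indicator_iff (hG0 s)]
    have h : Integrable (fun x : ℝ => x) ((P.restrict (G s)).map (M.Y (s + 1))) := by
      rw [hmap]
      exact (M.arm_int k).smul_measure (measure_ne_top _ _)
    exact (integrable_map_measure h.1 (hYm _).aemeasurable).1 h
  have hYval : ∀ s, ∀ φ : ℝ → ℝ, Measurable φ → ∫ ω in G s, φ (M.Y (s + 1) ω) ∂P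
      = P.real (G s) * ∫ x, φ x ∂(M.arm k) := by
    intro s φ hφ
    rw [← integral_map (hYm _).aemeasurable hφ.aestronglyMeasurable, hmap, integral_smul_measure]
    rfl
  have hNlim : ∀ᵐ ω ∂P, Tendsto (fun t => ∑ s ∈ Finset.range t,
      (G s).indicator (fun _ => (1 : ℝ)) ω) atTop (nhds (NkT ω)) := by
    filter_upwards [hNkT] with ω h
    refine h.congr fun t => ?_
    rw [← mab_stopped_sum M τ k (fun _ _ => (1 : ℝ)) ω t]
    simp [FilteredMAB.N]
  have hSlim : ∀ᵐ ω ∂P, Tendsto (fun t => ∑ s ∈ Finset.range t,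
      (G s).indicator (M.Y (s + 1)) ω) atTop (nhds (SkT ω)) := by
    filter_upwards [hSkT] with ω h
    refine h.congr fun t => ?_
    rw [← mab_stopped_sum M τ k M.Y ω t]
    rfl
  have h1int : ∀ s, Integrable ((G s).indicator (fun _ => (1 : ℝ))) P := fun s =>
    (integrable_const 1).indicator (hG0 s)
  have h1val : ∀ s, ∫ ω, (G s).indicator (fun _ => (1 : ℝ)) ω ∂P = P.real (G s) := by
    intro s
    rw [integral_indicator (hG0 s)]
    simp [Measure.real]
  have hsumP : Summable fun s => P.real (G s) := by
    refine summable_of_sum_range_le (c := ∫ ω, NkT ω ∂P) (fun _ => measureReal_nonneg) fun n => ?_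
    simp_rw [← h1val]
    rw [← integral_finsetSum _ (fun i _ => h1int i)]
    refine integral_mono_ae (integrable_finsetSum _ (fun i _ => h1int i)) hNint ?_
    filter_upwards [hNlim] with ω h
    refine Monotone.ge_of_tendsto ?_ h n
    refine monotone_nat_of_le_succ fun t => ?_
    rw [Finset.sum_range_succ]
    exact le_add_of_nonneg_right (Set.indicator_nonneg (fun _ _ => zero_le_one) _)
  have hN := integrable_limit_of_summable (fun s => (G s).indicator (fun _ => (1 : ℝ))) NkT h1int
    (by
      refine hsumP.congr fun s => ?_
      rw [← h1val]
      refine integral_congr_ae (ae_of_all _ fun ω => ?_)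
      by_cases h : ω ∈ G s <;> simp [h]) hNmeas hNlim
  have hS := integrable_limit_of_summable (fun s => (G s).indicator (M.Y (s + 1))) SkT hYint
    (by
      refine (hsumP.mul_right (∫ x, ‖x‖ ∂(M.arm k))).congr fun s => ?_
      rw [← hYval s (fun x => ‖x‖) measurable_norm, ← integral_indicator (hG0 s)]
      refine integral_congr_ae (ae_of_all _ fun ω => ?_)
      by_cases h : ω ∈ G s <;> simp [h]) hSmeas hSlim
  refine ⟨hS.1, ?_⟩
  refine hS.2.unique ?_
  have h := hN.2.mul_left (M.mu k)
  have he : (fun s => ∫ ω, (G s).indicator (M.Y (s + 1)) ω ∂P)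
      = fun s => M.mu k * ∫ ω, (G s).indicator (fun _ => (1 : ℝ)) ω ∂P := by
    funext s
    rw [h1val, integral_indicator (hG0 s), mul_comm]
    exact hYval s (fun x => x) measurable_id
  rw [he]
  exact h
end

section
/- In the filtered MAB setting, fix an arm k with 0 < E[N_k(𝒯)] < ∞ and N_k(𝒯) ≥ 1 almost surely. Then the stopped sample mean μ̂_k(𝒯) is integrable and its bias satisfies the identity E[μ̂_k(𝒯)] − μ_k = − Cov(μ̂_k(𝒯), N_k(𝒯)) / E[N_k(𝒯)], where the covariance is well defined because μ̂_k(𝒯)·N_k(𝒯) = S_k(𝒯) is integrable. -/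
open MeasureTheory ProbabilityTheory Filter

lemma mab_sum_stopped (g : ℕ → ℝ) (τ : ℕ∞) (t : ℕ) :
    ∑ s ∈ Finset.Icc 1 (min (t : ℕ∞) τ).toNat, g s
      = ∑ s ∈ Finset.range t, if ((s + 1 : ℕ) : ℕ∞) ≤ τ then g (s + 1) else 0 := by
  rw [← Finset.sum_filter]
  symm
  apply Finset.sum_bij (fun s _ => s + 1)
  · intro a ha
    simp only [Finset.mem_filter, Finset.mem_range, Finset.mem_Icc] at ha ⊢
    refine ⟨by omega, ?_⟩
    have h : ((a + 1 : ℕ) : ℕ∞) ≤ min (t : ℕ∞) τ := le_min (by exact_mod_cast ha.1) ha.2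
    have hne : min (t : ℕ∞) τ ≠ ⊤ := ne_top_of_le_ne_top (ENat.coe_ne_top t) (min_le_left _ _)
    have := ENat.toNat_le_toNat h hne
    rwa [ENat.toNat_natCast] at this
  · intro a _ b _ h
    omega
  · intro b hb
    simp only [Finset.mem_Icc] at hb
    have hne : min (t : ℕ∞) τ ≠ ⊤ := ne_top_of_le_ne_top (ENat.coe_ne_top t) (min_le_left _ _)
    have h : (b : ℕ∞) ≤ min (t : ℕ∞) τ := by
      rw [← ENat.coe_toNat hne]
      exact_mod_cast hb.2
    have h1 : (b : ℕ∞) ≤ t := h.trans (min_le_left _ _)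
    have h2 : b ≤ t := by exact_mod_cast h1
    refine ⟨b - 1, ?_, by omega⟩
    simp only [Finset.mem_filter, Finset.mem_range]
    refine ⟨by omega, ?_⟩
    rw [Nat.sub_add_cancel hb.1]
    exact h.trans (min_le_right _ _)
  · intro a _
    rfl

lemma mab_series {Ω : Type} [MeasurableSpace Ω] {P : Measure Ω}
    (f : ℕ → Ω → ℝ) (G : Ω → ℝ) (hf : ∀ s, Integrable (f s) P)
    (hsum : ∑' s, ∫⁻ ω, ‖f s ω‖ₑ ∂P ≠ ⊤) (hG : AEStronglyMeasurable G P)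
    (hlim : ∀ᵐ ω ∂P, Tendsto (fun t => ∑ s ∈ Finset.range t, f s ω) atTop (nhds (G ω))) :
    Integrable G P ∧ HasSum (fun s => ∫ ω, f s ω ∂P) (∫ ω, G ω ∂P) := by
  have hL : ∫⁻ ω, ∑' s, ‖f s ω‖ₑ ∂P ≠ ⊤ := by
    rwa [lintegral_tsum (fun s => (hf s).1.enorm)]
  refine ⟨⟨hG, ?_⟩, ?_⟩
  · refine lt_of_le_of_lt (lintegral_mono_ae ?_) (lt_top_iff_ne_top.2 hL)
    filter_upwards [hlim] with ω h
    refine le_of_tendsto h.enorm (Eventually.of_forall fun t => ?_)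
    exact (enorm_sum_le _ _).trans (ENNReal.sum_le_tsum _)
  · have hs : Summable fun s => ∫ ω, ‖f s ω‖ ∂P := by
      have := ENNReal.summable_toReal hsum
      refine this.congr fun s => ?_
      rw [integral_norm_eq_lintegral_enorm (hf s).1]
    have key := hasSum_integral_of_summable_integral_norm hf hs
    have hae : (fun ω => ∑' s, f s ω) =ᵐ[P] G := by
      have hfin := ae_lt_top' (AEMeasurable.ennreal_tsum fun s => (hf s).1.enorm) hL
      filter_upwards [hlim, hfin] with ω h1 h2
      have : Summable fun s => f s ω := by
        apply Summable.of_norm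
        have := ENNReal.summable_toReal h2.ne
        simpa using this
      exact tendsto_nhds_unique this.hasSum.tendsto_sum_nat h1
    rwa [integral_congr_ae hae] at key

lemma mab_law {Ω : Type} [MeasurableSpace Ω] {P : Measure Ω} [IsProbabilityMeasure P]
    {K : ℕ} (M : FilteredMAB Ω P K) (k : Fin K) (s : ℕ) (T : Set Ω)
    (hT : MeasurableSet[M.F s] T) :
    (P.restrict (M.A (s + 1) ⁻¹' {k} ∩ T)).map (M.Y (s + 1))
      = P (M.A (s + 1) ⁻¹' {k} ∩ T) • M.arm k := by
  have := M.arm_prob k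
  have hY : Measurable (M.Y (s + 1)) := (M.Y_adapted (s + 1)).mono (M.F.le _) le_rfl
  have hA : MeasurableSet (M.A (s + 1) ⁻¹' {k}) :=
    ((M.A_pred (s + 1) (by omega)).mono (M.F.le _) le_rfl) (measurableSet_singleton k)
  have hT' : MeasurableSet T := M.F.le s _ hT
  ext B hB
  rw [Measure.map_apply hY hB, Measure.restrict_apply (hY hB), Measure.smul_apply, smul_eq_mul]
  have hc := M.cond (s + 1) (by omega) k (B.indicator 1) (measurable_const.indicator hB)
    ⟨1, fun x => by by_cases h : x ∈ B <;> simp [h]⟩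
  rw [Nat.add_sub_cancel] at hc
  have e1 : (fun ω => if M.A (s + 1) ω = k then B.indicator (1 : ℝ → ℝ) (M.Y (s + 1) ω) else 0)
      = (M.A (s + 1) ⁻¹' {k} ∩ M.Y (s + 1) ⁻¹' B).indicator 1 := by
    ext ω
    by_cases h1 : M.A (s + 1) ω = k <;> by_cases h2 : M.Y (s + 1) ω ∈ B <;> simp [h1, h2]
  have e2 : (fun ω => if M.A (s + 1) ω = k then ∫ x, B.indicator (1 : ℝ → ℝ) x ∂(M.arm k) else 0)
      = (M.A (s + 1) ⁻¹' {k}).indicator fun _ => (M.arm k).real B := by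
    ext ω
    by_cases h1 : M.A (s + 1) ω = k <;> simp [h1, integral_indicator_one hB]
  rw [e1, e2] at hc
  have hi : Integrable ((M.A (s + 1) ⁻¹' {k} ∩ M.Y (s + 1) ⁻¹' B).indicator (1 : Ω → ℝ)) P :=
    (integrable_const (1 : ℝ)).indicator (hA.inter (hY hB))
  have h := setIntegral_condExp (M.F.le s) hi hT
  rw [setIntegral_congr_ae hT' (hc.mono fun ω h _ => h), setIntegral_indicator hA,
    integral_indicator_one (hA.inter (hY hB)), setIntegral_const, smul_eq_mul,
    measureReal_restrict_apply (hA.inter (hY hB))] at h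
  rw [← ENNReal.toReal_eq_toReal_iff' (measure_ne_top _ _)
    (ENNReal.mul_ne_top (measure_ne_top _ _) (measure_ne_top _ _)), ENNReal.toReal_mul]
  simp only [Measure.real] at h
  rw [Set.inter_comm _ T, h]
  congr 2
  ext ω
  simp only [Set.mem_inter_iff]
  tauto

/-- the bias expression for the stopped sample mean (Proposition 1).
In the filtered MAB setting, fix an arm `k` with `0 < E[N_k(𝒯)] < ∞` and `N_k(𝒯) ≥ 1`
almost surely; `N_k(𝒯)` and `S_k(𝒯)` are the a.s. limits of the stopped processes, and
`μ̂_k(𝒯) = S_k(𝒯)/N_k(𝒯)` is the stopped sample mean.  Then `μ̂_k(𝒯)` is integrable,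
`μ̂_k(𝒯)·N_k(𝒯) = S_k(𝒯)` is integrable (so the covariance
`Cov(μ̂_k(𝒯), N_k(𝒯)) = E[μ̂_k(𝒯)·N_k(𝒯)] − E[μ̂_k(𝒯)]·E[N_k(𝒯)]` is well defined), and
`E[μ̂_k(𝒯)] − μ_k = − Cov(μ̂_k(𝒯), N_k(𝒯)) / E[N_k(𝒯)]`. -/
theorem bias_expression_mab
    {Ω : Type} [MeasurableSpace Ω] {P : Measure Ω} [IsProbabilityMeasure P]
    {K : ℕ} (hK : 1 ≤ K) (M : FilteredMAB Ω P K)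
    (τ : Ω → ℕ∞)
    (hτ1 : ∀ ω, 1 ≤ τ ω)
    (hτ : ∀ t : ℕ, MeasurableSet[M.F t] {ω | τ ω ≤ t})
    (k : Fin K)
    (NkT SkT : Ω → ℝ)
    (hNkT : ∀ᵐ ω ∂P, Tendsto
      (fun t : ℕ => (M.N k (min (t : ℕ∞) (τ ω)).toNat ω : ℝ)) atTop (nhds (NkT ω)))
    (hSkT : ∀ᵐ ω ∂P, Tendsto
      (fun t : ℕ => M.S k (min (t : ℕ∞) (τ ω)).toNat ω) atTop (nhds (SkT ω)))
    (hNmeas : AEStronglyMeasurable NkT P) (hSmeas : AEStronglyMeasurable SkT P)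
    (hNint : Integrable NkT P)
    (hNpos : 0 < ∫ ω, NkT ω ∂P)
    (hN1 : ∀ᵐ ω ∂P, 1 ≤ NkT ω)
    (muhatT : Ω → ℝ)
    (hmuhatT : ∀ ω, muhatT ω = SkT ω / NkT ω) :
    Integrable muhatT P ∧
    Integrable (fun ω => muhatT ω * NkT ω) P ∧
    (∫ ω, muhatT ω ∂P) - M.mu k =
      - ((∫ ω, muhatT ω * NkT ω ∂P) - (∫ ω, muhatT ω ∂P) * (∫ ω, NkT ω ∂P))
        / (∫ ω, NkT ω ∂P) := by
  have hprob := M.arm_prob k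
  set T : ℕ → Set Ω := fun s => {ω | ((s + 1 : ℕ) : ℕ∞) ≤ τ ω} with hTdef
  have hT : ∀ s, MeasurableSet[M.F s] (T s) := by
    intro s
    have : T s = {ω | τ ω ≤ s}ᶜ := by
      ext ω
      simp only [hTdef, Set.mem_setOf_eq, Set.mem_compl_iff, not_le]
      push_cast
      exact ENat.add_one_le_iff (ENat.coe_ne_top s)
    rw [this]
    exact (hτ s).compl
  set C : ℕ → Set Ω := fun s => M.A (s + 1) ⁻¹' {k} ∩ T s with hCdef
  have hY : ∀ s, Measurable (M.Y (s + 1)) := fun s =>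
    (M.Y_adapted (s + 1)).mono (M.F.le _) le_rfl
  have hC : ∀ s, MeasurableSet (C s) := fun s =>
    (((M.A_pred (s + 1) (by omega)).mono (M.F.le _) le_rfl) (measurableSet_singleton k)).inter
      (M.F.le s _ (hT s))
  have hlaw : ∀ s, (P.restrict (C s)).map (M.Y (s + 1)) = P (C s) • M.arm k :=
    fun s => mab_law M k s (T s) (hT s)
  -- the increments
  have hNlim : ∀ᵐ ω ∂P, Tendsto (fun t => ∑ s ∈ Finset.range t,
      (C s).indicator (fun _ => (1 : ℝ)) ω) atTop (nhds (NkT ω)) := by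
    filter_upwards [hNkT] with ω h
    refine h.congr fun t => ?_
    simp only [FilteredMAB.N]
    push_cast
    rw [mab_sum_stopped (fun s => if M.A s ω = k then (1 : ℝ) else 0)]
    refine Finset.sum_congr rfl fun s _ => ?_
    by_cases h1 : M.A (s + 1) ω = k <;> by_cases h2 : (s : ℕ∞) + 1 ≤ τ ω <;>
      simp [hCdef, hTdef, Set.indicator, h1, h2]
  have hSlim : ∀ᵐ ω ∂P, Tendsto (fun t => ∑ s ∈ Finset.range t,
      (C s).indicator (M.Y (s + 1)) ω) atTop (nhds (SkT ω)) := by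
    filter_upwards [hSkT] with ω h
    refine h.congr fun t => ?_
    simp only [FilteredMAB.S]
    rw [mab_sum_stopped (fun s => if M.A s ω = k then M.Y s ω else 0)]
    refine Finset.sum_congr rfl fun s _ => ?_
    by_cases h1 : M.A (s + 1) ω = k <;> by_cases h2 : (s : ℕ∞) + 1 ≤ τ ω <;>
      simp [hCdef, hTdef, Set.indicator, h1, h2]
  have hNl : ∀ s, ∫⁻ ω, ‖(C s).indicator (fun _ => (1 : ℝ)) ω‖ₑ ∂P = P (C s) := by
    intro s
    simp_rw [enorm_indicator_eq_indicator_enorm]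
    rw [lintegral_indicator (hC s)]
    simp
  have hSl : ∀ s, ∫⁻ ω, ‖(C s).indicator (M.Y (s + 1)) ω‖ₑ ∂P
      = P (C s) * ∫⁻ x, ‖x‖ₑ ∂(M.arm k) := by
    intro s
    simp_rw [enorm_indicator_eq_indicator_enorm]
    rw [lintegral_indicator (hC s), ← lintegral_map (f := fun x : ℝ => ‖x‖ₑ) (by fun_prop) (hY s), hlaw,
      lintegral_smul_measure, smul_eq_mul]
  have hPC : ∑' s, P (C s) ≠ ⊤ := by
    have h1 : ∑' s, P (C s) = ∫⁻ ω, ∑' s, ‖(C s).indicator (fun _ => (1 : ℝ)) ω‖ₑ ∂P := by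
      rw [lintegral_tsum]
      · exact tsum_congr fun s => (hNl s).symm
      · intro s
        exact (measurable_const.indicator (hC s)).enorm.aemeasurable
    rw [h1]
    refine (lt_of_le_of_lt (lintegral_mono_ae ?_) hNint.2).ne
    filter_upwards [hNlim] with ω h
    refine le_of_eq (tendsto_nhds_unique (ENNReal.tendsto_nat_tsum _) (h.enorm.congr fun t => ?_))
    rw [Real.enorm_eq_ofReal (Finset.sum_nonneg fun s _ =>
      Set.indicator_nonneg (fun _ _ => zero_le_one) _), ENNReal.ofReal_sum_of_nonneg
      (fun s _ => Set.indicator_nonneg (fun _ _ => zero_le_one) _)]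
    refine Finset.sum_congr rfl fun s _ => ?_
    rw [Real.enorm_eq_ofReal (Set.indicator_nonneg (fun _ _ => zero_le_one) _)]
  have hm1 : ∫⁻ x, ‖x‖ₑ ∂(M.arm k) ≠ ⊤ := (M.arm_int k).2.ne
  obtain ⟨-, hN⟩ := mab_series (P := P) (fun s => (C s).indicator (fun _ => (1 : ℝ))) NkT
    (fun s => (integrable_const (1 : ℝ)).indicator (hC s)) (by simpa only [hNl] using hPC)
    hNmeas hNlim
  obtain ⟨hSint, hS⟩ := mab_series (P := P) (fun s => (C s).indicator (M.Y (s + 1))) SkT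
    (fun s => ⟨((hY s).indicator (hC s)).aestronglyMeasurable, by
      rw [HasFiniteIntegral, hSl]
      exact ENNReal.mul_lt_top (measure_lt_top _ _) (lt_top_iff_ne_top.2 hm1)⟩)
    (by
      simp only [hSl]
      rw [ENNReal.tsum_mul_right]
      exact ENNReal.mul_ne_top hPC hm1)
    hSmeas hSlim
  have hSN : ∫ ω, SkT ω ∂P = (∫ ω, NkT ω ∂P) * M.mu k := by
    refine hS.unique ((hN.mul_right (M.mu k)).congr_fun fun s => ?_)
    rw [integral_indicator (hC s), integral_indicator (hC s), setIntegral_const, smul_eq_mul,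
      mul_one, FilteredMAB.mu,
      ← integral_map (f := fun x : ℝ => x) (hY s).aemeasurable (by fun_prop), hlaw,
      integral_smul_measure, smul_eq_mul]
    rfl
  have hprod : (fun ω => muhatT ω * NkT ω) =ᵐ[P] SkT := by
    filter_upwards [hN1] with ω h
    rw [hmuhatT, div_mul_cancel₀]
    linarith
  have hmu : muhatT = fun ω => SkT ω / NkT ω := funext hmuhatT
  refine ⟨?_, hSint.congr hprod.symm, ?_⟩
  · refine hSint.mono ?_ ?_
    · rw [hmu]
      exact (hSmeas.aemeasurable.div hNmeas.aemeasurable).aestronglyMeasurable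
    · filter_upwards [hN1] with ω h
      rw [hmuhatT, norm_div]
      apply div_le_self (norm_nonneg _)
      rw [Real.norm_eq_abs]
      exact h.trans (le_abs_self _)
  · rw [integral_congr_ae hprod, hSN]
    field_simp
    ring
end
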